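/- arXiv:1401.0499 — 2 statements merged into one kernel-verified Lean document; each statement's English description precedes it below -/
import Mathlib

section
/- Let X be a G-space with basepoint o and let h ∈ G be strongly contracting for the action of G on X, with axis 𝓗 and nearest-point projections π_{f𝓗}. Let K ≥ 0 and let A ⊆ G be a subset with 1 ∈ A such that (i) diam(π_{f𝓗}(o) ∪ π_{f𝓗}(a·o)) ≤ K for every f ∈ G and every a ∈ A, and (ii) a·𝓗 ≠ a′·𝓗 for all distinct a, a′ ∈ A. Then there exists N such that for every n ≥ N the following map is injective: the map sending each finite nonempty sequence (a_1, …, a_k) of elements of A∖{1} to the point a_1 h^n a_2 h^n ⋯ a_k h^n · o ∈ X; that is, if a_1 h^n ⋯ a_k h^n · o = a′_1 h^n ⋯ a′_{k′} h^n · o with all a_i, a′_j ∈ A∖{1}, then k = k′ and a_i = a′_i for all i. -/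
open Filter Metric
open scoped ENNReal

section Defs

variable {G : Type*} {X : Type*} [Group G] [MetricSpace X] [MulAction G X]

/-- A geodesic from `x` to `y`: an isometric parameterization of `[0, dist x y]`. -/
def GeodesicFromTo (γ : ℝ → X) (x y : X) : Prop :=
  γ 0 = x ∧ γ (dist x y) = y ∧
    ∀ s ∈ Set.Icc (0 : ℝ) (dist x y), ∀ t ∈ Set.Icc (0 : ℝ) (dist x y),
      dist (γ s) (γ t) = |s - t|

/-- A geodesic metric space. -/
def GeodesicSpace (X : Type*) [MetricSpace X] : Prop :=
  ∀ x y : X, ∃ γ : ℝ → X, GeodesicFromTo γ x y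

/-- The action of `G` on `X` is by isometries. -/
def IsometricAction (G X : Type*) [Group G] [MetricSpace X] [MulAction G X] : Prop :=
  ∀ (g : G) (x y : X), dist (g • x) (g • y) = dist x y

/-- The action of `G` on `X` is properly discontinuous. -/
def ProperlyDiscontinuousAction (G X : Type*) [Group G] [MetricSpace X] [MulAction G X] : Prop :=
  ∀ K : Set X, IsCompact K → {g : G | ((g • ·) '' K ∩ K).Nonempty}.Finite

/-- `G` is non-elementary: no cyclic subgroup has finite index. -/
def NonElementary (G : Type*) [Group G] : Prop :=
  ∀ g : G, (Subgroup.zpowers g).index = 0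

/-- Growth exponent of a subset `A ⊆ G`, with respect to basepoint `o`. -/
noncomputable def growthExp (o : X) (A : Set G) : ℝ≥0∞ :=
  Filter.limsup (fun r : ℝ =>
    ENNReal.ofReal (Real.log (Nat.card {g : G // g ∈ A ∧ dist o (g • o) ≤ r}) / r))
    Filter.atTop

/-- Growth exponent of the quotient `G ⧸ Γ` with the induced pseudo-metric. -/
noncomputable def quotGrowthExp (o : X) (Γ : Subgroup G) : ℝ≥0∞ :=
  Filter.limsup (fun r : ℝ =>
    ENNReal.ofReal (Real.log (Nat.card
      {q : G ⧸ Γ // ∃ g : G, QuotientGroup.mk g = q ∧ (⨅ γ : Γ, dist o ((g * γ) • o)) ≤ r}) / r))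
    Filter.atTop

/-- A growth tight action. -/
def GrowthTight (G : Type*) [Group G] {X : Type*} [MetricSpace X] [MulAction G X] (o : X) : Prop :=
  ∀ Γ : Subgroup G, Γ.Normal → (Γ : Set G).Infinite →
    quotGrowthExp o Γ < growthExp o (Set.univ : Set G)

/-- The `⟨h⟩`-orbit of the basepoint. -/
def zOrbit (o : X) (h : G) : Set X := Set.range fun i : ℤ => h ^ i • o

/-- Nearest point projection to a subset. -/
def nprojSet (S : Set X) (x : X) : Set X := {a ∈ S | dist x a = Metric.infDist x S}

/-- `h` is a strongly contracting element for `G ↷ X`. -/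
def StronglyContractingElem (o : X) (h : G) : Prop :=
  ¬ IsOfFinOrder h ∧
  (∃ M C : ℝ, 1 ≤ M ∧ 0 ≤ C ∧ ∀ i j : ℤ,
    (1 / M) * |(i : ℝ) - (j : ℝ)| - C ≤ dist (h ^ i • o) (h ^ j • o) ∧
    dist (h ^ i • o) (h ^ j • o) ≤ M * |(i : ℝ) - (j : ℝ)| + C) ∧
  (∃ C : ℝ, 0 ≤ C ∧ ∀ x y : X,
    dist x y < Metric.infDist x (zOrbit o h) - C →
    Metric.diam (nprojSet (zOrbit o h) x ∪ nprojSet (zOrbit o h) y) ≤ C)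

/-- The elementary closure `E(h)`: elements whose translate of the `⟨h⟩`-orbit of `o` is
coarsely equivalent to it. -/
def Eh (o : X) (h : G) : Set G :=
  {g : G | ∃ c : ℝ, 0 ≤ c ∧
    (∀ x ∈ (g • ·) '' zOrbit o h, Metric.infDist x (zOrbit o h) ≤ c) ∧
    (∀ x ∈ zOrbit o h, Metric.infDist x ((g • ·) '' zOrbit o h) ≤ c)}

/-- The axis `𝓗 = E(h)·o` of a strongly contracting element `h`. -/
def axisSet (o : X) (h : G) : Set X := (· • o) '' Eh o h

end Defs

section MetricLemmas

variable {X : Type*} [MetricSpace X] {S T : Set X} {C D : ℝ} {x y p q : X}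

theorem dist_le_of_mem_nprojSet (hp : p ∈ nprojSet S x) (hy : y ∈ S) : dist x p ≤ dist x y :=
  hp.2 ▸ infDist_le_dist_of_mem hy

theorem self_mem_nprojSet (hx : x ∈ S) : x ∈ nprojSet S x :=
  ⟨hx, by rw [dist_self, infDist_zero_of_mem hx]⟩

theorem isBounded_nprojSet_union (S : Set X) (x y : X) :
    Bornology.IsBounded (nprojSet S x ∪ nprojSet S y) := by
  refine Bornology.IsBounded.union ?_ ?_
  · exact isBounded_closedBall.subset fun p hp => by
      rw [mem_closedBall, dist_comm]; exact hp.2.le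
  · exact isBounded_closedBall.subset fun p hp => by
      rw [mem_closedBall, dist_comm]; exact hp.2.le

theorem dist_le_of_diam_nprojSet_union_le
    (hd : diam (nprojSet S x ∪ nprojSet S y) ≤ D) (hp : p ∈ nprojSet S x)
    (hq : q ∈ nprojSet S y) : dist p q ≤ D :=
  (dist_le_diam_of_mem (isBounded_nprojSet_union S x y) (Or.inl hp) (Or.inr hq)).trans hd

/-- Pointwise form of strong contraction: balls disjoint from `S` have projections of diameter
at most `C`, up to shrinking the balls by `C`. -/
def BallContracting (C : ℝ) (S : Set X) : Prop :=
  ∀ ⦃x y p q : X⦄, p ∈ nprojSet S x → q ∈ nprojSet S y → dist x y < dist x p - C → dist p q ≤ C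

/-- Two points with distant projections to `S` are joined by an almost geodesic path that runs
along `S` between these projections. -/
def PathContracting (C : ℝ) (S : Set X) : Prop :=
  ∀ ⦃x y p q : X⦄, p ∈ nprojSet S x → q ∈ nprojSet S y → C < dist p q →
    dist x p + dist p q + dist q y ≤ dist x y + C

theorem dist_le_of_forall_sub_le {F : ℝ → X} {a b σ : ℝ} (hσ : 0 < σ) (hC : 0 ≤ C) (hab : a ≤ b)
    (hF : ∀ s t, a ≤ s → s ≤ t → t ≤ b → t - s ≤ σ → dist (F s) (F t) ≤ C) :
    dist (F a) (F b) ≤ C * ((b - a) / σ + 1) := by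
  have key : ∀ (n : ℕ) (t : ℝ), a ≤ t → t ≤ b → t - a ≤ n * σ → dist (F a) (F t) ≤ n * C := by
    intro n
    induction n with
    | zero =>
      intro t hat _ ht
      have : t = a := le_antisymm (by simpa using ht) hat
      simp [this]
    | succ n ih =>
      intro t hat htb ht
      push_cast at ht ⊢
      by_cases hts : t - a ≤ σ
      · have := hF a t le_rfl hat htb hts
        nlinarith [n.cast_nonneg (α := ℝ)]
      · have h1 := ih (t - σ) (by linarith) (by linarith) (by linarith)
        have h2 := hF (t - σ) t (by linarith) (by linarith) htb (by linarith)
        linarith [dist_triangle (F a) (F (t - σ)) (F t)]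
  have h0 : 0 ≤ (b - a) / σ := div_nonneg (by linarith) hσ.le
  have h1 := key ⌈(b - a) / σ⌉₊ b hab le_rfl (by
    rw [← div_le_iff₀ hσ]; exact Nat.le_ceil _)
  have h2 := (Nat.ceil_lt_add_one h0).le
  nlinarith

theorem GeodesicFromTo.reverse {γ : ℝ → X} (hγ : GeodesicFromTo γ x y) :
    GeodesicFromTo (fun t => γ (dist x y - t)) y x := by
  obtain ⟨h0, h1, h2⟩ := hγ
  refine ⟨by simpa using h1, by simpa [dist_comm y x] using h0, fun s hs t ht => ?_⟩
  rw [dist_comm y x] at hs ht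
  rw [h2 _ ⟨by linarith [hs.2], by linarith [hs.1]⟩ _ ⟨by linarith [ht.2], by linarith [ht.1]⟩,
    abs_sub_comm]
  congr 1
  ring

theorem BallContracting.dist_le_of_geodesic_avoids (hS : BallContracting C S) (hC : 0 ≤ C)
    (hex : ∀ x, (nprojSet S x).Nonempty) {γ : ℝ → X} (hγ : GeodesicFromTo γ x y) {a b : ℝ}
    (ha : 0 ≤ a) (hab : a ≤ b) (hb : b ≤ dist x y)
    (hav : ∀ t, a ≤ t → t ≤ b → 5 * C + 5 ≤ infDist (γ t) S)
    (hp : p ∈ nprojSet S (γ a)) (hq : q ∈ nprojSet S (γ b)) : dist p q ≤ 5 * C + 1 := by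
  choose r hr using hex
  have hd : ∀ s t, a ≤ s → s ≤ t → t ≤ b → dist (γ s) (γ t) = t - s := by
    intro s t hs hst ht
    rw [hγ.2.2 s ⟨by linarith, by linarith⟩ t ⟨by linarith, by linarith⟩, abs_sub_comm,
      abs_of_nonneg (by linarith)]
  have hα : 5 * C + 5 ≤ dist (γ a) p := by rw [hp.2]; exact hav a le_rfl hab
  have hβ : 5 * C + 5 ≤ dist (γ b) q := by rw [hq.2]; exact hav b hab le_rfl
  have hL := hd a b le_rfl hab le_rfl
  have htri : dist (γ a) (γ b) ≤ dist (γ a) p + dist p q + dist (γ b) q := by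
    have := dist_triangle4 (γ a) p q (γ b)
    rwa [dist_comm q] at this
  set α := dist (γ a) p with hαd
  set β := dist (γ b) q with hβd
  by_cases h1 : b - a < α - C
  · linarith [hS hp hq (by rw [hL]; exact h1)]
  by_cases h2 : b - a < β - C
  · linarith [hS hq hp (by rw [dist_comm, hL]; exact h2), dist_comm p q]
  have e1 : dist p (r (γ (a + (α - C - 1)))) ≤ C := hS hp (hr _) (by
    rw [hd a _ le_rfl (by linarith) (by linarith)]; linarith)
  have e2 : dist q (r (γ (b - (β - C - 1)))) ≤ C := hS hq (hr _) (by
    rw [dist_comm, hd _ b (by linarith) (by linarith) le_rfl]; linarith)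
  by_cases h3 : b - (β - C - 1) ≤ a + (α - C - 1)
  · have e3 : dist q (r (γ (a + (α - C - 1)))) ≤ C := hS hq (hr _) (by
      rw [dist_comm, hd _ b (by linarith) (by linarith) le_rfl]; linarith)
    linarith [dist_triangle_right p q (r (γ (a + (α - C - 1))))]
  · have e3 := dist_le_of_forall_sub_le (F := fun t => r (γ t)) (a := a + (α - C - 1))
      (b := b - (β - C - 1)) (σ := 4 * (C + 1)) (by linarith) hC (by linarith) (by
        intro s t hs hst ht hts
        refine hS (hr _) (hr _) ?_
        rw [hd s t (by linarith) hst (by linarith), (hr (γ s)).2]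
        linarith [hav s (by linarith) (by linarith)])
    set u := b - (β - C - 1) - (a + (α - C - 1)) with hu
    have hu0 : 0 < u := by linarith
    have e4 : C * (u / (4 * (C + 1)) + 1) ≤ u / 4 + C := by
      have : C * (u / (4 * (C + 1))) ≤ u / 4 := by
        rw [mul_div_assoc', div_le_div_iff₀ (by linarith) (by norm_num)]
        nlinarith
      linarith
    have e5 := dist_triangle4 p (r (γ (a + (α - C - 1)))) (r (γ (b - (β - C - 1)))) q
    have e6 := dist_comm q (r (γ (b - (β - C - 1))))
    linarith

theorem BallContracting.exists_first_entry (hS : BallContracting C S) (hC : 0 ≤ C)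
    (hex : ∀ x, (nprojSet S x).Nonempty) {γ : ℝ → X} (hγ : GeodesicFromTo γ x y)
    (hp : p ∈ nprojSet S x)
    (hne : ∃ t ∈ Set.Icc 0 (dist x y), infDist (γ t) S ≤ 5 * C + 5) :
    ∃ t ∈ Set.Icc 0 (dist x y), infDist (γ t) S ≤ 5 * C + 5 ∧
      (∀ s ∈ Set.Icc 0 (dist x y), infDist (γ s) S ≤ 5 * C + 5 → t ≤ s) ∧
      dist (γ t) p ≤ 10 * C + 6 := by
  have hcont : ContinuousOn (fun t => infDist (γ t) S) (Set.Icc 0 (dist x y)) := by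
    refine (continuous_infDist_pt S).comp_continuousOn ?_
    refine LipschitzOnWith.continuousOn (K := 1) (LipschitzOnWith.of_dist_le_mul ?_)
    intro s hs t ht
    simp [hγ.2.2 s hs t ht, Real.dist_eq]
  have hcomp :
      IsCompact (Set.Icc 0 (dist x y) ∩ (fun t => infDist (γ t) S) ⁻¹' Set.Iic (5 * C + 5)) :=
    isCompact_Icc.of_isClosed_subset (hcont.preimage_isClosed_of_isClosed isClosed_Icc isClosed_Iic)
      Set.inter_subset_left
  obtain ⟨t, ⟨ht, htS⟩, hmin⟩ := hcomp.exists_isLeast (by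
    obtain ⟨t, ht, h⟩ := hne
    exact ⟨t, ht, h⟩)
  have hmin' : ∀ s ∈ Set.Icc 0 (dist x y), infDist (γ s) S ≤ 5 * C + 5 → t ≤ s :=
    fun s hs h => hmin ⟨hs, h⟩
  replace htS : infDist (γ t) S ≤ 5 * C + 5 := htS
  refine ⟨t, ht, htS, hmin', ?_⟩
  rcases ht.1.eq_or_lt with h0 | h0
  · rw [← h0, hγ.1, hp.2]
    rw [← h0, hγ.1] at htS
    linarith
  obtain ⟨q, hq⟩ := hex (γ t)
  have hlt : ∀ s, 0 ≤ s → s < t → 5 * C + 5 < infDist (γ s) S := by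
    intro s hs hst
    by_contra! h
    linarith [hmin' s ⟨hs, by linarith [ht.2]⟩ h]
  have hav : ∀ s, 0 ≤ s → s ≤ t → 5 * C + 5 ≤ infDist (γ s) S := by
    intro s hs hst
    rcases hst.lt_or_eq with h | rfl
    · exact (hlt s hs h).le
    by_contra! hcon
    set δ := min s (5 * C + 5 - infDist (γ s) S) with hδ
    have hδ0 : 0 < δ := lt_min h0 (by linarith)
    have hδ1 : δ ≤ s := min_le_left _ _
    have hδ2 : δ ≤ 5 * C + 5 - infDist (γ s) S := min_le_right _ _
    have h1 := hlt (s - δ) (by linarith) (by linarith)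
    have h2 := infDist_le_infDist_add_dist (s := S) (x := γ (s - δ)) (y := γ s)
    rw [hγ.2.2 (s - δ) ⟨by linarith, by linarith [ht.2]⟩ s ht, abs_sub_comm,
      abs_of_nonneg (by linarith)] at h2
    linarith
  have h1 := hS.dist_le_of_geodesic_avoids hC hex hγ le_rfl ht.1 ht.2 hav
    (by rw [hγ.1]; exact hp) hq
  have h2 := hq.2
  linarith [dist_triangle (γ t) q p, dist_comm p q]

theorem BallContracting.pathContracting (hgeo : GeodesicSpace X) (hS : BallContracting C S)
    (hC : 0 ≤ C) (hex : ∀ x, (nprojSet S x).Nonempty) : PathContracting (40 * C + 24) S := by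
  intro x y p q hp hq hpq
  obtain ⟨γ, hγ⟩ := hgeo x y
  have hne : ∃ t ∈ Set.Icc 0 (dist x y), infDist (γ t) S ≤ 5 * C + 5 := by
    by_contra! hcon
    have := hS.dist_le_of_geodesic_avoids hC hex hγ le_rfl dist_nonneg le_rfl
      (fun t h0 h1 => (hcon t ⟨h0, h1⟩).le) (by rw [hγ.1]; exact hp) (by rw [hγ.2.1]; exact hq)
    linarith
  have hne' : ∃ t ∈ Set.Icc 0 (dist y x), infDist (γ (dist x y - t)) S ≤ 5 * C + 5 := by
    obtain ⟨t, ht, h⟩ := hne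
    refine ⟨dist x y - t, ⟨by linarith [ht.2], by linarith [ht.1, dist_comm x y]⟩, ?_⟩
    simpa using h
  obtain ⟨t, ht, -, hmin, htp⟩ := hS.exists_first_entry hC hex hγ hp hne
  obtain ⟨s, hs, hsS, -, hsq⟩ := hS.exists_first_entry hC hex hγ.reverse hq hne'
  rw [dist_comm y x] at hs
  have hs' : dist x y - s ∈ Set.Icc 0 (dist x y) := ⟨by linarith [hs.2], by linarith [hs.1]⟩
  have hts := hmin _ hs' hsS
  have d1 : dist x (γ t) = t := by
    have := hγ.2.2 0 ⟨le_rfl, dist_nonneg⟩ t ht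
    rwa [hγ.1, zero_sub, abs_neg, abs_of_nonneg ht.1] at this
  have d2 : dist (γ t) (γ (dist x y - s)) = dist x y - s - t := by
    rw [hγ.2.2 t ht _ hs', abs_sub_comm, abs_of_nonneg (by linarith)]
  have d3 : dist (γ (dist x y - s)) y = s := by
    have := hγ.2.2 _ hs' (dist x y) ⟨dist_nonneg, le_rfl⟩
    rw [hγ.2.1, abs_sub_comm, abs_of_nonneg (by linarith [hs.1])] at this
    linarith
  have t1 := dist_triangle x (γ t) p
  have t2 := dist_triangle4 p (γ t) (γ (dist x y - s)) q
  have t3 := dist_triangle_left q y (γ (dist x y - s))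
  linarith [dist_comm p (γ t)]

theorem PathContracting.dist_add_dist_le (hS : PathContracting C S) (hC : 0 ≤ C)
    (hp : p ∈ nprojSet S x) (hy : y ∈ S) : dist x p + dist p y ≤ dist x y + 2 * C := by
  by_cases h : C < dist p y
  · have := hS hp (self_mem_nprojSet hy) h
    rw [dist_self] at this
    linarith
  · linarith [dist_le_of_mem_nprojSet hp hy]

theorem PathContracting.dist_le_of_hausdorff_close (hS : PathContracting C S) (hC : 0 ≤ C)
    (hST : ∀ s ∈ S, ∃ t ∈ T, dist s t ≤ D) (hTS : ∀ t ∈ T, ∃ s ∈ S, dist t s ≤ D)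
    (hp : p ∈ nprojSet S x) (hq : q ∈ nprojSet T x) : dist p q ≤ 3 * D + 2 * C := by
  obtain ⟨s, hs, hqs⟩ := hTS q hq.1
  obtain ⟨t, ht, hpt⟩ := hST p hp.1
  have h1 := dist_le_of_mem_nprojSet hq ht
  have h2 := hS.dist_add_dist_le hC hp hs
  linarith [dist_triangle x p t, dist_triangle x q s, dist_triangle_right p q s]

/-- A form of the Behrstock inequality. -/
theorem PathContracting.dist_le_of_lt_dist {u v w : X} (hS : PathContracting C S)
    (hT : PathContracting C T) (hC : 0 ≤ C) (hp : p ∈ nprojSet T x) (hu : u ∈ nprojSet S x)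
    (hv : v ∈ nprojSet S p) (hw : w ∈ nprojSet T v) (huv : C < dist u v) :
    dist p w ≤ 2 * C := by
  by_cases h : C < dist p w
  · have h1 := hS hu hv huv
    have h2 := hT hp hw h
    linarith [dist_triangle x u v, dist_nonneg (x := v) (y := p), dist_nonneg (x := w) (y := v)]
  · linarith

theorem PathContracting.two_mul_dist_le {y₁ y₂ u : X} (hS : PathContracting C S)
    (hT : PathContracting C T) (hC : 0 ≤ C) (hy₁ : y₁ ∈ T) (hy₂ : y₂ ∈ T)
    (hp : p ∈ nprojSet S y₁) (hq : q ∈ nprojSet S y₂) (hpq : C < dist p q)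
    (hu : u ∈ nprojSet T p) : 2 * dist p u ≤ 5 * C := by
  have h1 := hS hp hq hpq
  have h2 := hT.dist_add_dist_le hC hu hy₁
  have h3 := hT.dist_add_dist_le hC hu hy₂
  linarith [dist_triangle p q y₂, dist_triangle_left y₁ y₂ u, dist_comm p y₁]

/-- A `ℤ`-indexed quasi-geodesic with constants `M` and `C`. -/
def IsQuasigeodesic (M C : ℝ) (y : ℤ → X) : Prop :=
  ∀ i j : ℤ, (1 / M) * |(i : ℝ) - (j : ℝ)| - C ≤ dist (y i) (y j) ∧
    dist (y i) (y j) ≤ M * |(i : ℝ) - (j : ℝ)| + C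

theorem BallContracting.exists_excursion_bound (hS : BallContracting C S) (hC : 0 ≤ C)
    (hex : ∀ x, (nprojSet S x).Nonempty) {M C₁ : ℝ} (hM : 1 ≤ M) (hC₁ : 0 ≤ C₁) :
    ∃ R : ℝ, 0 ≤ R ∧ ∀ y : ℤ → X, IsQuasigeodesic M C₁ y → ∀ a b : ℤ, a ≤ b →
      (∀ i, a ≤ i → i ≤ b → R ≤ infDist (y i) S) →
      (b : ℝ) - a ≤ 2 * M * (infDist (y a) S + infDist (y b) S + C + C₁) := by
  choose r hr using hex
  set k : ℕ := ⌈2 * M * C⌉₊ + 1 with hk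
  have hk0 : (0 : ℝ) < k := by rw [hk]; positivity
  have hkM : 2 * M * C ≤ k := by
    rw [hk]; push_cast; linarith [Nat.le_ceil (2 * M * C)]
  have hM0 : 0 < M := by linarith
  refine ⟨M * k + C₁ + C + 1, by positivity, fun y hy a b hab hav => ?_⟩
  have hab' : (a : ℝ) ≤ b := by exact_mod_cast hab
  have h1 := dist_le_of_forall_sub_le (F := fun t : ℝ => r (y ⌊t⌋)) (a := a) (b := b) hk0 hC
    hab' (by
    intro s t hs hst ht hts
    refine hS (hr _) (hr _) ?_
    have hfs : a ≤ ⌊s⌋ := Int.le_floor.2 hs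
    have hfst : ⌊s⌋ ≤ ⌊t⌋ := Int.floor_mono hst
    have hft : ⌊t⌋ ≤ b := by
      have := Int.floor_mono ht
      rwa [Int.floor_intCast] at this
    have hfk : ⌊t⌋ ≤ ⌊s⌋ + k := by
      rw [← Int.floor_add_natCast]
      exact Int.floor_mono (by linarith)
    have hfst' : (⌊s⌋ : ℝ) ≤ ⌊t⌋ := by exact_mod_cast hfst
    have hfk' : (⌊t⌋ : ℝ) ≤ ⌊s⌋ + k := by exact_mod_cast hfk
    have h2 := (hy ⌊s⌋ ⌊t⌋).2
    rw [abs_sub_comm, abs_of_nonneg (by linarith)] at h2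
    rw [(hr (y ⌊s⌋)).2]
    have h3 := hav ⌊s⌋ hfs (hfst.trans hft)
    nlinarith)
  simp only [Int.floor_intCast] at h1
  have h2 := (hy a b).1
  rw [abs_sub_comm, abs_of_nonneg (by linarith)] at h2
  have h3 := dist_triangle4 (y a) (r (y a)) (r (y b)) (y b)
  rw [(hr (y a)).2, dist_comm (r (y b)), (hr (y b)).2] at h3
  have h4 : C * (((b : ℝ) - a) / k) ≤ 1 / M * (b - a) / 2 := by
    rw [mul_div_assoc', one_div_mul_eq_div, div_div, div_le_div_iff₀ hk0 (by positivity)]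
    nlinarith
  have h5 : 1 / M * ((b : ℝ) - a) / 2 ≤ infDist (y a) S + infDist (y b) S + C + C₁ := by linarith
  rw [one_div_mul_eq_div, div_div, div_le_iff₀ (by positivity)] at h5
  linarith

/-- Morse property: a quasi-geodesic segment with endpoints close to `S` stays close to `S`. -/
theorem BallContracting.exists_morse_bound (hS : BallContracting C S) (hC : 0 ≤ C)
    (hex : ∀ x, (nprojSet S x).Nonempty) {M C₁ : ℝ} (hM : 1 ≤ M) (hC₁ : 0 ≤ C₁) (E : ℝ) :
    ∃ D : ℝ, 0 ≤ D ∧ ∀ y : ℤ → X, IsQuasigeodesic M C₁ y → ∀ a i b : ℤ, a ≤ i → i ≤ b →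
      infDist (y a) S ≤ E → infDist (y b) S ≤ E → infDist (y i) S ≤ D := by
  obtain ⟨R₀, hR₀, hexc⟩ := hS.exists_excursion_bound hC hex hM hC₁
  set R := max R₀ E with hR
  have hRR : R₀ ≤ R := le_max_left _ _
  have hER : E ≤ R := le_max_right _ _
  have hM0 : 0 < M := by linarith
  have hR0 : 0 ≤ R := hR₀.trans hRR
  refine ⟨R + M * (2 * M * (2 * R + 2 * M + 3 * C₁ + C) + 2) + C₁, by positivity,
    fun y hy a i b hai hib ha hb => ?_⟩
  by_cases hi : infDist (y i) S ≤ R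
  · have : 0 ≤ M * (2 * M * (2 * R + 2 * M + 3 * C₁ + C) + 2) + C₁ := by positivity
    linarith
  obtain ⟨a', ⟨ha'i, ha'⟩, hmax⟩ := Int.exists_greatest_of_bdd
    (P := fun j => j ≤ i ∧ infDist (y j) S ≤ R) ⟨i, fun j hj => hj.1⟩ ⟨a, hai, ha.trans hER⟩
  obtain ⟨b', ⟨hb'i, hb'⟩, hmin⟩ := Int.exists_least_of_bdd
    (P := fun j => i ≤ j ∧ infDist (y j) S ≤ R) ⟨i, fun j hj => hj.1⟩ ⟨b, hib, hb.trans hER⟩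
  have hai' : a' < i := lt_of_le_of_ne ha'i fun h => hi (h ▸ ha')
  have hbi' : i < b' := lt_of_le_of_ne hb'i fun h => hi (h ▸ hb')
  have h1 := hexc y hy (a' + 1) (b' - 1) (by omega) (by
    intro j hj1 hj2
    by_contra! hcon
    rcases le_total j i with hji | hji
    · have := hmax j ⟨hji, by linarith⟩
      omega
    · have := hmin j ⟨hji, by linarith⟩
      omega)
  have h2 := infDist_le_infDist_add_dist (s := S) (x := y (a' + 1)) (y := y a')
  have h3 := infDist_le_infDist_add_dist (s := S) (x := y (b' - 1)) (y := y b')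
  have h4 := infDist_le_infDist_add_dist (s := S) (x := y i) (y := y a')
  have h5 := (hy (a' + 1) a').2
  have h6 := (hy (b' - 1) b').2
  have h7 := (hy i a').2
  push_cast at h1 h5 h6
  have e5 : |(a' : ℝ) + 1 - a'| = 1 := by simp
  have e6 : |(b' : ℝ) - 1 - b'| = 1 := by simp
  have hai'' : (a' : ℝ) < i := by exact_mod_cast hai'
  have hbi'' : (i : ℝ) < b' := by exact_mod_cast hbi'
  rw [e5] at h5
  rw [e6] at h6
  rw [abs_of_pos (by linarith)] at h7
  have h8 : infDist (y (a' + 1)) S + infDist (y (b' - 1)) S + C + C₁ ≤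
      2 * R + 2 * M + 3 * C₁ + C := by linarith
  have h9 : (i : ℝ) - a' ≤ 2 * M * (2 * R + 2 * M + 3 * C₁ + C) + 2 := by
    have := mul_le_mul_of_nonneg_left h8 (by positivity : 0 ≤ 2 * M)
    linarith
  have := mul_le_mul_of_nonneg_left h9 hM0.le
  linarith

/-- A bi-infinite quasi-geodesic in a bounded neighborhood of `S` is uniformly close to `S`. -/
theorem BallContracting.exists_uniform_bound (hS : BallContracting C S) (hC : 0 ≤ C)
    (hex : ∀ x, (nprojSet S x).Nonempty) {M C₁ : ℝ} (hM : 1 ≤ M) (hC₁ : 0 ≤ C₁) :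
    ∃ D : ℝ, 0 ≤ D ∧ ∀ y : ℤ → X, IsQuasigeodesic M C₁ y →
      ∀ c : ℝ, (∀ i, infDist (y i) S ≤ c) → ∀ i, infDist (y i) S ≤ D := by
  obtain ⟨R, hR, hexc⟩ := hS.exists_excursion_bound hC hex hM hC₁
  obtain ⟨D, hD, hmorse⟩ := hS.exists_morse_bound hC hex hM hC₁ R
  refine ⟨D, hD, fun y hy c hc i => ?_⟩
  have hM0 : 0 < M := by linarith
  have hret : ∀ a b : ℤ, a ≤ b → 2 * M * (2 * c + C + C₁) < (b : ℝ) - a →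
      ∃ j, a ≤ j ∧ j ≤ b ∧ infDist (y j) S ≤ R := by
    intro a b hab hlt
    by_contra! hcon
    have h1 := hexc y hy a b hab fun j h1 h2 => (hcon j h1 h2).le
    have h2 := mul_le_mul_of_nonneg_left (add_le_add (hc a) (hc b)) (by positivity : 0 ≤ 2 * M)
    linarith
  obtain ⟨n, hn⟩ := exists_nat_gt (2 * M * (2 * c + C + C₁))
  obtain ⟨a, -, hai, ha⟩ := hret (i - n) i (by omega) (by push_cast; linarith)
  obtain ⟨b, hib, -, hb⟩ := hret i (i + n) (by omega) (by push_cast; linarith)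
  exact hmorse y hy a i b hai hib ha hb

end MetricLemmas

section Action

variable {G X : Type*} [Group G] [MulAction G X]

theorem image_inv_smul_image (g : G) (S : Set X) : (g⁻¹ • ·) '' ((g • ·) '' S) = S := by
  rw [Set.image_image]
  simp

theorem zOrbit_eq_image (o : X) (h : G) :
    zOrbit o h = (· • o) '' (Subgroup.zpowers h : Set G) := by
  ext x
  simp [zOrbit, Subgroup.mem_zpowers_iff]

theorem zpow_smul_mem_zOrbit (o : X) (h : G) (i : ℤ) : h ^ i • o ∈ zOrbit o h := ⟨i, rfl⟩

theorem self_mem_zOrbit (o : X) (h : G) : o ∈ zOrbit o h := ⟨0, by simp⟩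

theorem smul_mem_image_zOrbit (o : X) (h a : G) : a • o ∈ (a • ·) '' zOrbit o h :=
  Set.mem_image_of_mem _ (self_mem_zOrbit o h)

theorem image_zpow_smul_zOrbit (o : X) (h : G) (n : ℤ) :
    (h ^ n • ·) '' zOrbit o h = zOrbit o h := by
  ext x
  constructor
  · rintro ⟨_, ⟨i, rfl⟩, rfl⟩
    exact ⟨n + i, by simp [zpow_add, mul_smul]⟩
  · rintro ⟨i, rfl⟩
    exact ⟨h ^ (i - n) • o, ⟨i - n, rfl⟩, by simp [← mul_smul, ← zpow_add]⟩

variable [MetricSpace X]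

theorem ProperlyDiscontinuousAction.finite_dist_le [ProperSpace X]
    (hPD : ProperlyDiscontinuousAction G X) (o : X) (D : ℝ) :
    {g : G | dist (g • o) o ≤ D}.Finite := by
  refine (hPD (closedBall o (max D 0)) (isCompact_closedBall _ _)).subset fun g hg => ?_
  exact ⟨g • o, ⟨o, by simp, rfl⟩, by simpa using Or.inl hg⟩

theorem ProperlyDiscontinuousAction.nprojSet_nonempty [ProperSpace X]
    (hPD : ProperlyDiscontinuousAction G X) {B : Set G} (hB : B.Nonempty) (x : X) :
    (nprojSet ((· • o) '' B) x).Nonempty := by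
  obtain ⟨b, hb⟩ := hB
  have hfin : {g : G | g ∈ B ∧ dist x (g • o) ≤ dist x (b • o)}.Finite := by
    refine (hPD.finite_dist_le o (dist x (b • o) + dist x o)).subset fun g hg => ?_
    have := dist_triangle_left (g • o) o x
    have := hg.2
    exact show dist (g • o) o ≤ _ by linarith
  obtain ⟨g, ⟨hgB, hg⟩, hmin⟩ :=
    Set.exists_min_image _ (fun g => dist x (g • o)) hfin ⟨b, hb, le_rfl⟩
  have hmem : g • o ∈ (· • o) '' B := ⟨g, hgB, rfl⟩
  refine ⟨g • o, hmem, le_antisymm ?_ (infDist_le_dist_of_mem hmem)⟩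
  refine (le_infDist ((Set.nonempty_of_mem hb).image _)).2 ?_
  rintro _ ⟨g', hg', rfl⟩
  by_cases hle : dist x (g' • o) ≤ dist x (b • o)
  · exact hmin g' ⟨hg', hle⟩
  · exact hg.trans (not_le.1 hle).le

theorem ProperlyDiscontinuousAction.nprojSet_zOrbit_nonempty [ProperSpace X]
    (hPD : ProperlyDiscontinuousAction G X) (o : X) (h : G) (x : X) :
    (nprojSet (zOrbit o h) x).Nonempty := by
  rw [zOrbit_eq_image]
  exact hPD.nprojSet_nonempty ⟨1, one_mem _⟩ x

theorem mem_Eh_iff {o : X} {h g : G} : g ∈ Eh o h ↔ ∃ c : ℝ, ∀ i : ℤ,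
    (∃ j : ℤ, dist ((g * h ^ i) • o) (h ^ j • o) ≤ c) ∧
      ∃ j : ℤ, dist (h ^ i • o) ((g * h ^ j) • o) ≤ c := by
  have hne : (zOrbit o h).Nonempty := ⟨o, self_mem_zOrbit o h⟩
  constructor
  · rintro ⟨c, -, h1, h2⟩
    refine ⟨c + 1, fun i => ⟨?_, ?_⟩⟩
    · have h3 := h1 _ (Set.mem_image_of_mem _ (zpow_smul_mem_zOrbit o h i))
      obtain ⟨_, ⟨j, rfl⟩, hj⟩ := (infDist_lt_iff hne).1 (h3.trans_lt (lt_add_one c))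
      exact ⟨j, by rw [mul_smul]; exact hj.le⟩
    · have h3 := h2 _ (zpow_smul_mem_zOrbit o h i)
      obtain ⟨_, ⟨_, ⟨j, rfl⟩, rfl⟩, hj⟩ :=
        (infDist_lt_iff (hne.image _)).1 (h3.trans_lt (lt_add_one c))
      exact ⟨j, by rw [mul_smul]; exact hj.le⟩
  · rintro ⟨c, hc⟩
    refine ⟨c, ?_, ?_, ?_⟩
    · obtain ⟨j, hj⟩ := (hc 0).1
      exact dist_nonneg.trans hj
    · rintro _ ⟨_, ⟨i, rfl⟩, rfl⟩
      obtain ⟨j, hj⟩ := (hc i).1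
      rw [mul_smul] at hj
      exact (infDist_le_dist_of_mem (zpow_smul_mem_zOrbit o h j)).trans hj
    · rintro _ ⟨i, rfl⟩
      obtain ⟨j, hj⟩ := (hc i).2
      rw [mul_smul] at hj
      exact (infDist_le_dist_of_mem
        (Set.mem_image_of_mem _ (zpow_smul_mem_zOrbit o h j))).trans hj

theorem zpow_mem_Eh (o : X) (h : G) (n : ℤ) : h ^ n ∈ Eh o h :=
  mem_Eh_iff.2 ⟨0, fun i => ⟨⟨n + i, by simp [zpow_add]⟩, ⟨i - n, by simp [← zpow_add]⟩⟩⟩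

variable [IsIsometricSMul G X] {o : X} {h : G} {S : Set X} {C : ℝ} {x p : X}

theorem dist_smul_comm_inv (g : G) (x y : X) : dist (g • x) y = dist x (g⁻¹ • y) := by
  rw [← dist_smul g⁻¹ (g • x), inv_smul_smul]

theorem smul_mem_nprojSet (g : G) (hp : p ∈ nprojSet S x) :
    g • p ∈ nprojSet ((g • ·) '' S) (g • x) := by
  refine ⟨Set.mem_image_of_mem _ hp.1, ?_⟩
  rw [dist_smul, hp.2]
  exact (infDist_image (isometry_smul X g)).symm

theorem inv_smul_mem_nprojSet (g : G) (hp : p ∈ nprojSet ((g • ·) '' S) x) :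
    g⁻¹ • p ∈ nprojSet S (g⁻¹ • x) := by
  have := smul_mem_nprojSet g⁻¹ hp
  rwa [image_inv_smul_image] at this

theorem PathContracting.image_smul (hS : PathContracting C S) (g : G) :
    PathContracting C ((g • ·) '' S) := by
  intro x y p q hp hq hpq
  have := hS (inv_smul_mem_nprojSet g hp) (inv_smul_mem_nprojSet g hq) (by rwa [dist_smul])
  simpa only [dist_smul] using this

theorem ProperlyDiscontinuousAction.nprojSet_image_zOrbit_nonempty [ProperSpace X]
    (hPD : ProperlyDiscontinuousAction G X) (o : X) (h g : G) (x : X) :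
    (nprojSet ((g • ·) '' zOrbit o h) x).Nonempty := by
  obtain ⟨p, hp⟩ := hPD.nprojSet_zOrbit_nonempty o h (g⁻¹ • x)
  have := smul_mem_nprojSet g hp
  rw [smul_inv_smul] at this
  exact ⟨_, this⟩

theorem infDist_inv_smul (g : G) (x : X) (S : Set X) :
    infDist (g⁻¹ • x) S = infDist x ((g • ·) '' S) := by
  rw [← infDist_image (isometry_smul X g)]
  simp

theorem mul_mem_Eh {g g' : G} (hg : g ∈ Eh o h) (hg' : g' ∈ Eh o h) : g * g' ∈ Eh o h := by
  obtain ⟨c, hc⟩ := mem_Eh_iff.1 hg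
  obtain ⟨c', hc'⟩ := mem_Eh_iff.1 hg'
  refine mem_Eh_iff.2 ⟨c + c', fun i => ⟨?_, ?_⟩⟩
  · obtain ⟨j, hj⟩ := (hc' i).1
    obtain ⟨k, hk⟩ := (hc j).1
    refine ⟨k, ?_⟩
    rw [← dist_smul g, ← mul_smul, ← mul_smul, ← mul_assoc] at hj
    linarith [dist_triangle ((g * g' * h ^ i) • o) ((g * h ^ j) • o) (h ^ k • o)]
  · obtain ⟨j, hj⟩ := (hc i).2
    obtain ⟨k, hk⟩ := (hc' j).2
    refine ⟨k, ?_⟩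
    rw [← dist_smul g, ← mul_smul, ← mul_smul, ← mul_assoc] at hk
    linarith [dist_triangle (h ^ i • o) ((g * h ^ j) • o) ((g * g' * h ^ k) • o)]

theorem inv_mem_Eh {g : G} (hg : g ∈ Eh o h) : g⁻¹ ∈ Eh o h := by
  obtain ⟨c, hc⟩ := mem_Eh_iff.1 hg
  refine mem_Eh_iff.2 ⟨c, fun i => ⟨?_, ?_⟩⟩
  · obtain ⟨j, hj⟩ := (hc i).2
    exact ⟨j, by rwa [mul_smul, dist_smul_comm_inv, inv_inv, ← mul_smul]⟩
  · obtain ⟨j, hj⟩ := (hc i).1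
    exact ⟨j, by rwa [mul_smul, dist_comm, dist_smul_comm_inv, inv_inv, ← mul_smul, dist_comm]⟩

theorem image_smul_axisSet_of_mem_Eh {g : G} (hg : g ∈ Eh o h) :
    (g • ·) '' axisSet o h = axisSet o h := by
  ext x
  constructor
  · rintro ⟨_, ⟨e, he, rfl⟩, rfl⟩
    exact ⟨g * e, mul_mem_Eh hg he, mul_smul _ _ _⟩
  · rintro ⟨e, he, rfl⟩
    exact ⟨(g⁻¹ * e) • o, ⟨g⁻¹ * e, mul_mem_Eh (inv_mem_Eh hg) he, rfl⟩, by simp [mul_smul]⟩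

theorem isQuasigeodesic_smul {M C₁ : ℝ} (hq : IsQuasigeodesic M C₁ fun i => h ^ i • o) (g : G) :
    IsQuasigeodesic M C₁ fun i => g • h ^ i • o := fun i j => by
  simpa only [dist_smul] using hq i j

/-- An element conjugating a power of `h` to a nontrivial power of `h` lies in `E(h)`. -/
theorem mem_Eh_of_mul_zpow_eq {M C₁ : ℝ} (hq : IsQuasigeodesic M C₁ fun i => h ^ i • o)
    (hM : 0 ≤ M) {g : G} {m n : ℤ} (hm : m ≠ 0) (hn : n ≠ 0) (hg : g * h ^ m = h ^ n * g) :
    g ∈ Eh o h := by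
  have hpow : ∀ k : ℤ, g * h ^ (m * k) = h ^ (n * k) * g := by
    intro k
    rw [zpow_mul, zpow_mul]
    exact (SemiconjBy.zpow_right (show SemiconjBy g (h ^ m) (h ^ n) from hg) k)
  have hrem : ∀ (l i : ℤ), l ≠ 0 → dist (h ^ (i % l) • o) o ≤ M * |(l : ℝ)| + C₁ := by
    intro l i hl
    have h1 := (hq (i % l) 0).2
    simp only [zpow_zero, one_smul, Int.cast_zero, sub_zero] at h1
    have h2 : |((i % l : ℤ) : ℝ)| ≤ |(l : ℝ)| := by
      rw [abs_of_nonneg (by exact_mod_cast Int.emod_nonneg i hl)]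
      exact_mod_cast (Int.emod_lt_abs i hl).le
    linarith [mul_le_mul_of_nonneg_left h2 hM]
  refine mem_Eh_iff.2 ⟨dist (g • o) o + (M * |(m : ℝ)| + C₁) + (M * |(n : ℝ)| + C₁),
    fun i => ⟨⟨n * (i / m), ?_⟩, ⟨m * (i / n), ?_⟩⟩⟩
  · have h1 : g * h ^ i = h ^ (n * (i / m)) * (g * h ^ (i % m)) := by
      rw [← mul_assoc, ← hpow, mul_assoc, ← zpow_add, Int.mul_ediv_add_emod]
    rw [h1, mul_smul, dist_smul, mul_smul]
    have h2 := hrem m i hm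
    have h3 := dist_nonneg.trans (hrem n i hn)
    have h4 := dist_triangle (g • h ^ (i % m) • o) (g • o) o
    rw [dist_smul] at h4
    linarith
  · have h1 : h ^ i = h ^ (n * (i / n)) * h ^ (i % n) := by
      rw [← zpow_add, Int.mul_ediv_add_emod]
    rw [hpow, h1, mul_smul, mul_smul, dist_smul]
    have h2 := hrem n i hn
    have h3 := dist_nonneg.trans (hrem m i hm)
    linarith [dist_triangle_right (h ^ (i % n) • o) (g • o) o]

/-- Projections of translates of `⟨h⟩ o` by elements outside `E(h)` are uniformly bounded. -/
theorem exists_dist_le_of_notMem_Eh [ProperSpace X] (hPD : ProperlyDiscontinuousAction G X)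
    (hord : ¬ IsOfFinOrder h) {M C₁ C C₂ : ℝ} (hM : 1 ≤ M) (hC₁ : 0 ≤ C₁)
    (hq : IsQuasigeodesic M C₁ fun i => h ^ i • o)
    (hC : 0 ≤ C) (hball : BallContracting C (zOrbit o h))
    (hC₂ : 0 ≤ C₂) (hpath : PathContracting C₂ (zOrbit o h)) :
    ∃ B : ℝ, 0 ≤ B ∧ ∀ g ∉ Eh o h, ∀ x ∈ (g • ·) '' zOrbit o h, ∀ y ∈ (g • ·) '' zOrbit o h,
      ∀ p ∈ nprojSet (zOrbit o h) x, ∀ q ∈ nprojSet (zOrbit o h) y, dist p q ≤ B := by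
  have hex : ∀ x, (nprojSet (zOrbit o h) x).Nonempty := hPD.nprojSet_zOrbit_nonempty o h
  obtain ⟨D, -, hmorse⟩ := hball.exists_morse_bound hC hex hM hC₁ (5 * C₂ / 2)
  have hfin := hPD.finite_dist_le o D
  set F := hfin.toFinset with hF
  have hM0 : 0 ≤ M := by linarith
  have key : ∀ g ∉ Eh o h, ∀ a b : ℤ, a ≤ b →
      infDist (h ^ a • o) ((g • ·) '' zOrbit o h) ≤ 5 * C₂ / 2 →
      infDist (h ^ b • o) ((g • ·) '' zOrbit o h) ≤ 5 * C₂ / 2 → (b : ℝ) - a ≤ F.card := by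
    intro g hg a b hab ha hb
    by_contra! hlt
    have hs : ∀ t : ℤ, ∃ s : ℤ, a ≤ t → t ≤ b →
        dist ((h ^ (-t) * g * h ^ s) • o) o ≤ D := by
      intro t
      by_cases ht : a ≤ t ∧ t ≤ b
      · have h1 := hmorse _ (isQuasigeodesic_smul hq g⁻¹) a t b ht.1 ht.2
          (by rwa [infDist_inv_smul]) (by rwa [infDist_inv_smul])
        obtain ⟨_, ⟨⟨s, rfl⟩, hs⟩⟩ := hex (g⁻¹ • h ^ t • o)
        refine ⟨s, fun _ _ => ?_⟩
        rw [← hs, dist_smul_comm_inv, inv_inv, dist_smul_comm_inv] at h1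
        rw [dist_comm]
        simpa [mul_smul] using h1
      · exact ⟨0, fun h1 h2 => absurd ⟨h1, h2⟩ ht⟩
    choose s hs using hs
    have hcard : F.card < (Finset.Icc a b).card := by
      rw [Int.card_Icc]
      have : (F.card : ℤ) < b - a := by exact_mod_cast hlt
      omega
    obtain ⟨t, ht, t', ht', hne, heq⟩ := Finset.exists_ne_map_eq_of_card_lt_of_maps_to hcard
      (f := fun t => h ^ (-t) * g * h ^ s t) (fun t ht => by
        rw [Finset.mem_coe, Finset.mem_Icc] at ht
        simpa [hF] using hs t ht.1 ht.2)
    have hrel : g * h ^ (s t - s t') = h ^ (t - t') * g := by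
      have h1 : h ^ (-t) * g * h ^ s t = h ^ (-t') * g * h ^ s t' := heq
      calc g * h ^ (s t - s t') = h ^ t * (h ^ (-t) * g * h ^ s t) * h ^ (-s t') := by
            rw [sub_eq_add_neg, zpow_add]; group
        _ = h ^ (t - t') * g := by rw [h1, sub_eq_add_neg, zpow_add]; group
    have hn : t - t' ≠ 0 := sub_ne_zero.2 hne
    refine hg (mem_Eh_of_mul_zpow_eq hq hM0 (fun hm => ?_) hn hrel)
    rw [hm, zpow_zero, mul_one, eq_comm, mul_eq_right] at hrel
    exact hord (isOfFinOrder_iff_zpow_eq_one.2 ⟨_, hn, hrel⟩)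
  refine ⟨C₂ + (M * F.card + C₁), by positivity, fun g hg x hx y hy p hp q hq' => ?_⟩
  by_contra! hlt
  have hpath' := hpath.image_smul g
  have hpos : 0 ≤ M * F.card + C₁ := by positivity
  have hnear : ∀ {x y p q : X}, x ∈ (g • ·) '' zOrbit o h → y ∈ (g • ·) '' zOrbit o h →
      p ∈ nprojSet (zOrbit o h) x → q ∈ nprojSet (zOrbit o h) y → C₂ < dist p q →
      infDist p ((g • ·) '' zOrbit o h) ≤ 5 * C₂ / 2 := by
    intro x y p q hx hy hp hq hpq
    obtain ⟨u, hu⟩ := hPD.nprojSet_image_zOrbit_nonempty o h g p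
    have := hpath.two_mul_dist_le hpath' hC₂ hx hy hp hq hpq hu
    rw [← hu.2]
    linarith
  have hpn := hnear hx hy hp hq' (by linarith)
  have hqn := hnear hy hx hq' hp (by linarith [dist_comm p q])
  obtain ⟨⟨a, rfl⟩, -⟩ := hp
  obtain ⟨⟨b, rfl⟩, -⟩ := hq'
  have hab : |(a : ℝ) - b| ≤ F.card := by
    rw [abs_le]
    rcases le_total a b with hab | hab
    · have h1 := key g hg a b hab hpn hqn
      have h2 : (a : ℝ) ≤ b := by exact_mod_cast hab
      constructor <;> linarith
    · have h1 := key g hg b a hab hqn hpn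
      have h2 : (b : ℝ) ≤ a := by exact_mod_cast hab
      constructor <;> linarith
  have h1 := (hq a b).2
  have h2 := mul_le_mul_of_nonneg_left hab hM0
  simp only at hlt
  linarith

/-- The axis `E(h) o` is at bounded Hausdorff distance from `⟨h⟩ o`. -/
theorem exists_axisSet_close [ProperSpace X] (hPD : ProperlyDiscontinuousAction G X)
    {M C₁ C : ℝ} (hM : 1 ≤ M) (hC₁ : 0 ≤ C₁)
    (hq : IsQuasigeodesic M C₁ fun i => h ^ i • o)
    (hC : 0 ≤ C) (hball : BallContracting C (zOrbit o h)) :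
    ∃ D : ℝ, 0 ≤ D ∧ (∀ s ∈ zOrbit o h, ∃ t ∈ axisSet o h, dist s t ≤ D) ∧
      ∀ t ∈ axisSet o h, ∃ s ∈ zOrbit o h, dist t s ≤ D := by
  have hex : ∀ x, (nprojSet (zOrbit o h) x).Nonempty := hPD.nprojSet_zOrbit_nonempty o h
  obtain ⟨D, hD, hunif⟩ := hball.exists_uniform_bound hC hex hM hC₁
  refine ⟨D, hD, ?_, ?_⟩
  · rintro _ ⟨i, rfl⟩
    exact ⟨h ^ i • o, ⟨h ^ i, zpow_mem_Eh o h i, rfl⟩, by simpa using hD⟩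
  · rintro _ ⟨g, ⟨c, -, hc, -⟩, rfl⟩
    have h1 := hunif _ (isQuasigeodesic_smul hq g) c
      (fun i => hc _ (Set.mem_image_of_mem _ (zpow_smul_mem_zOrbit o h i))) 0
    obtain ⟨s, hs⟩ := hex (g • o)
    refine ⟨s, hs.1, ?_⟩
    rw [hs.2]
    simpa using h1

theorem dist_le_of_diam_axisSet_le [ProperSpace X] (hPD : ProperlyDiscontinuousAction G X)
    {C D K : ℝ} (hC : 0 ≤ C) (hpath : PathContracting C (zOrbit o h))
    (hST : ∀ s ∈ zOrbit o h, ∃ t ∈ axisSet o h, dist s t ≤ D)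
    (hTS : ∀ t ∈ axisSet o h, ∃ s ∈ zOrbit o h, dist t s ≤ D) {f : G} {x y p q : X}
    (hd : diam (nprojSet ((f • ·) '' axisSet o h) x ∪ nprojSet ((f • ·) '' axisSet o h) y) ≤ K)
    (hp : p ∈ nprojSet ((f • ·) '' zOrbit o h) x) (hq : q ∈ nprojSet ((f • ·) '' zOrbit o h) y) :
    dist p q ≤ K + 2 * (3 * D + 2 * C) := by
  obtain ⟨p', hp'⟩ := hPD.nprojSet_nonempty (o := o) ⟨_, zpow_mem_Eh o h 0⟩ (f⁻¹ • x)
  obtain ⟨q', hq'⟩ := hPD.nprojSet_nonempty (o := o) ⟨_, zpow_mem_Eh o h 0⟩ (f⁻¹ • y)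
  have h1 := hpath.dist_le_of_hausdorff_close hC hST hTS (inv_smul_mem_nprojSet f hp) hp'
  have h2 := hpath.dist_le_of_hausdorff_close hC hST hTS (inv_smul_mem_nprojSet f hq) hq'
  have hp'' := smul_mem_nprojSet f hp'
  have hq'' := smul_mem_nprojSet f hq'
  rw [smul_inv_smul] at hp'' hq''
  have h3 := dist_le_of_diam_nprojSet_union_le hd hp'' hq''
  rw [dist_smul] at h3
  have h4 := dist_triangle4 (f⁻¹ • p) p' q' (f⁻¹ • q)
  rw [dist_smul, dist_comm q'] at h4
  linarith

end Action

section PingPong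

variable {G X : Type*} [Group G] [MetricSpace X] [MulAction G X] {o : X} {h : G} {A : Set G}
  {C B K : ℝ}

/-- The configuration of translates of `⟨h⟩ o` used in the ping-pong argument: they are
contracting, translates by distinct elements of `A` have bounded projections to each other,
and elements of `A` displace `o` by a bounded amount as seen from any translate. -/
structure IsPingPongSet (o : X) (h : G) (A : Set G) (C B K : ℝ) : Prop where
  C_nonneg : 0 ≤ C
  B_nonneg : 0 ≤ B
  K_nonneg : 0 ≤ K
  one_mem : 1 ∈ A
  nprojSet_nonempty : ∀ (f : G) (x : X), (nprojSet ((f • ·) '' zOrbit o h) x).Nonempty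
  pathContracting : ∀ f : G, PathContracting C ((f • ·) '' zOrbit o h)
  dist_le_of_mem_translate : ∀ a ∈ A, ∀ b ∈ A, a ≠ b → ∀ x ∈ (b • ·) '' zOrbit o h,
    ∀ y ∈ (b • ·) '' zOrbit o h, ∀ p ∈ nprojSet ((a • ·) '' zOrbit o h) x,
    ∀ q ∈ nprojSet ((a • ·) '' zOrbit o h) y, dist p q ≤ B
  dist_le_of_mem : ∀ f : G, ∀ a ∈ A, ∀ p ∈ nprojSet ((f • ·) '' zOrbit o h) o,
    ∀ q ∈ nprojSet ((f • ·) '' zOrbit o h) (a • o), dist p q ≤ K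

theorem IsPingPongSet.dist_smul_le (hP : IsPingPongSet o h A C B K) {a : G} (ha : a ∈ A) {p : X}
    (hp : p ∈ nprojSet ((a • ·) '' zOrbit o h) o) : dist p (a • o) ≤ K :=
  hP.dist_le_of_mem a a ha p hp _ (self_mem_nprojSet (smul_mem_image_zOrbit o h a))

theorem IsPingPongSet.dist_smul_le_two_mul (hP : IsPingPongSet o h A C B K) {a b : G} (ha : a ∈ A)
    (hb : b ∈ A) {p : X}
    (hp : p ∈ nprojSet ((a • ·) '' zOrbit o h) (b • o)) : dist p (a • o) ≤ 2 * K := by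
  obtain ⟨q, hq⟩ := hP.nprojSet_nonempty a o
  have h1 := hP.dist_le_of_mem a b hb q hq p hp
  have h2 := hP.dist_smul_le ha hq
  linarith [dist_triangle_left p (a • o) q]

theorem IsPingPongSet.dist_le_of_lt_dist (hP : IsPingPongSet o h A C B K) {a b : G} (ha : a ∈ A)
    (hb : b ∈ A) (hab : a ≠ b) {x u p : X} (hu : u ∈ nprojSet ((a • ·) '' zOrbit o h) x)
    (hua : 2 * C + B + 2 * K < dist u (a • o)) (hp : p ∈ nprojSet ((b • ·) '' zOrbit o h) x) :
    dist p (b • o) ≤ 2 * C + B + 2 * K := by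
  obtain ⟨v, hv⟩ := hP.nprojSet_nonempty a p
  obtain ⟨v', hv'⟩ := hP.nprojSet_nonempty a (b • o)
  obtain ⟨w, hw⟩ := hP.nprojSet_nonempty b v
  obtain ⟨w', hw'⟩ := hP.nprojSet_nonempty b (a • o)
  have hC := hP.C_nonneg
  have h1 := hP.dist_le_of_mem_translate a ha b hb hab p hp.1 (b • o) (smul_mem_image_zOrbit o h b)
    v hv v' hv'
  have h2 := hP.dist_smul_le_two_mul ha hb hv'
  have h3 := hP.dist_le_of_mem_translate b hb a ha hab.symm v hv.1 (a • o)
    (smul_mem_image_zOrbit o h a) w hw w' hw'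
  have h4 := hP.dist_smul_le_two_mul hb ha hw'
  have h5 := (hP.pathContracting a).dist_le_of_lt_dist (hP.pathContracting b) hC hp hu hv hw (by
    linarith [dist_triangle4 u v v' (a • o)])
  linarith [dist_triangle4 p w w' (b • o)]

variable [IsIsometricSMul G X]

theorem lt_dist_of_forall_dist_le {T : ℝ} {a w : G} {n : ℕ}
    (hw : ∀ p ∈ nprojSet (zOrbit o h) (w • o), dist p o ≤ T) (hn : 2 * T < dist o (h ^ n • o))
    {u : X} (hu : u ∈ nprojSet ((a • ·) '' zOrbit o h) ((a * h ^ n * w) • o)) :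
    T < dist u (a • o) := by
  have h1 := inv_smul_mem_nprojSet a hu
  rw [← image_zpow_smul_zOrbit o h n, zpow_natCast] at h1
  have h2 := inv_smul_mem_nprojSet _ h1
  rw [mul_assoc, mul_smul, inv_smul_smul, mul_smul, inv_smul_smul] at h2
  have h3 := hw _ h2
  rw [dist_smul_comm_inv, inv_inv] at h3
  have h4 := dist_smul_comm_inv a⁻¹ u o
  rw [inv_inv] at h4
  linarith [dist_triangle_left o (h ^ n • o) (a⁻¹ • u)]

theorem IsPingPongSet.dist_prod_le (hP : IsPingPongSet o h A C B K) {n : ℕ}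
    (hn : 2 * (2 * C + B + 2 * K) < dist o (h ^ n • o)) (l : List G)
    (hl : ∀ a ∈ l, a ∈ A ∧ a ≠ 1) :
    ∀ p ∈ nprojSet (zOrbit o h) ((l.map (fun a => a * h ^ n)).prod • o),
      dist p o ≤ 2 * C + B + 2 * K := by
  induction l with
  | nil =>
    intro p hp
    have hC := hP.C_nonneg
    have hB := hP.B_nonneg
    have hK := hP.K_nonneg
    have h1 := dist_le_of_mem_nprojSet hp (self_mem_zOrbit o h)
    simp only [List.map_nil, List.prod_nil, one_smul, dist_self] at h1
    rw [dist_comm]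
    linarith
  | cons a l ih =>
    intro p hp
    rw [List.forall_mem_cons] at hl
    rw [List.map_cons, List.prod_cons] at hp
    obtain ⟨u, hu⟩ := hP.nprojSet_nonempty a ((a * h ^ n * (l.map (fun a => a * h ^ n)).prod) • o)
    have h1 := lt_dist_of_forall_dist_le (ih hl.2) hn hu
    have h2 := hP.dist_le_of_lt_dist hl.1.1 hP.one_mem hl.1.2 hu h1 (p := p) (by simpa using hp)
    rwa [one_smul] at h2

theorem IsPingPongSet.lt_dist_cons (hP : IsPingPongSet o h A C B K) {n : ℕ}
    (hn : 2 * (2 * C + B + 2 * K) < dist o (h ^ n • o)) {a : G} {l : List G}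
    (hl : ∀ b ∈ a :: l, b ∈ A ∧ b ≠ 1) {u : X}
    (hu : u ∈ nprojSet ((a • ·) '' zOrbit o h)
      (((a :: l).map (fun a => a * h ^ n)).prod • o)) :
    2 * C + B + 2 * K < dist u (a • o) := by
  rw [List.map_cons, List.prod_cons] at hu
  exact lt_dist_of_forall_dist_le
    (hP.dist_prod_le hn l fun b hb => hl b (List.mem_cons_of_mem a hb)) hn hu

theorem IsPingPongSet.prod_cons_smul_ne (hP : IsPingPongSet o h A C B K) {n : ℕ}
    (hn : 2 * (2 * C + B + 2 * K) < dist o (h ^ n • o)) {a : G} {l : List G}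
    (hl : ∀ b ∈ a :: l, b ∈ A ∧ b ≠ 1) :
    ((a :: l).map (fun a => a * h ^ n)).prod • o ≠ o := by
  intro heq
  obtain ⟨u, hu⟩ := hP.nprojSet_nonempty a o
  have h1 := hP.lt_dist_cons hn hl (u := u) (by rw [heq]; exact hu)
  have h2 := hP.dist_smul_le (hl a List.mem_cons_self).1 hu
  linarith [hP.C_nonneg, hP.B_nonneg, hP.K_nonneg]

theorem IsPingPongSet.eq_of_prod_smul_eq (hP : IsPingPongSet o h A C B K) {n : ℕ}
    (hn : 2 * (2 * C + B + 2 * K) < dist o (h ^ n • o)) (l l' : List G)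
    (hl : ∀ a ∈ l, a ∈ A ∧ a ≠ 1) (hl' : ∀ a ∈ l', a ∈ A ∧ a ≠ 1)
    (heq : (l.map (fun a => a * h ^ n)).prod • o = (l'.map (fun a => a * h ^ n)).prod • o) :
    l = l' := by
  induction l generalizing l' with
  | nil =>
    cases l' with
    | nil => rfl
    | cons b l' => exact absurd (by simpa using heq.symm) (hP.prod_cons_smul_ne hn hl')
  | cons a l ih =>
    cases l' with
    | nil => exact absurd (by simpa using heq) (hP.prod_cons_smul_ne hn hl)
    | cons b l' =>
      by_cases hab : a = b
      · subst hab
        rw [ih l' (List.forall_mem_cons.1 hl).2 (List.forall_mem_cons.1 hl').2]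
        simpa [mul_smul] using heq
      · obtain ⟨u, hu⟩ := hP.nprojSet_nonempty a (((a :: l).map (fun a => a * h ^ n)).prod • o)
        obtain ⟨v, hv⟩ := hP.nprojSet_nonempty b (((a :: l).map (fun a => a * h ^ n)).prod • o)
        have h1 := hP.dist_le_of_lt_dist (hl a List.mem_cons_self).1 (hl' b List.mem_cons_self).1
          hab hu (hP.lt_dist_cons hn hl hu) hv
        exact absurd h1 (not_le.2 (hP.lt_dist_cons hn hl' (heq ▸ hv)))

end PingPong

/-- **Proposition (embedding a free product set).** Given a strongly contracting element `h`
with axis `𝓗` and a subset `A ∋ 1` of `G` whose elements have uniformly bounded projections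
to all translates of `𝓗` and define distinct translates of `𝓗`, for all sufficiently
large `n` the map `(a₁, …, a_k) ↦ a₁ hⁿ a₂ hⁿ ⋯ a_k hⁿ · o` is injective on nonempty
sequences of elements of `A \ {1}`. -/
theorem free_product_set_embeds
    {G X : Type*} [Group G] [MetricSpace X] [MulAction G X] (o : X)
    (hProp : ProperSpace X) (hGeo : GeodesicSpace X)
    (hIso : IsometricAction G X) (hPD : ProperlyDiscontinuousAction G X)
    (h : G) (hSC : StronglyContractingElem o h)
    (K : ℝ) (hK : 0 ≤ K) (A : Set G) (hA1 : (1 : G) ∈ A)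
    (hproj : ∀ f : G, ∀ a ∈ A,
      Metric.diam (nprojSet ((f • ·) '' axisSet o h) o ∪
        nprojSet ((f • ·) '' axisSet o h) (a • o)) ≤ K)
    (hdistinct : ∀ a ∈ A, ∀ a' ∈ A, a ≠ a' →
      (a • ·) '' axisSet o h ≠ (a' • ·) '' axisSet o h) :
    ∃ N : ℕ, ∀ n : ℕ, N ≤ n →
      ∀ l l' : List G, l ≠ [] → l' ≠ [] →
        (∀ a ∈ l, a ∈ A ∧ a ≠ 1) → (∀ a ∈ l', a ∈ A ∧ a ≠ 1) →
        (l.map (fun a => a * h ^ n)).prod • o = (l'.map (fun a => a * h ^ n)).prod • o →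
        l = l' := by
  have : IsIsometricSMul G X := ⟨fun g => Isometry.of_dist_eq (hIso g)⟩
  obtain ⟨hord, ⟨M, C₁, hM, hC₁, hq⟩, C, hC, hcontr⟩ := hSC
  have hex : ∀ x, (nprojSet (zOrbit o h) x).Nonempty := hPD.nprojSet_zOrbit_nonempty o h
  have hball : BallContracting C (zOrbit o h) := fun x y p q hp hq' hlt =>
    dist_le_of_diam_nprojSet_union_le (hcontr x y (hp.2 ▸ hlt)) hp hq'
  have hC₂ : 0 ≤ 40 * C + 24 := by linarith
  have hpath := hball.pathContracting hGeo hC hex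
  obtain ⟨B, hB, hbdd⟩ := exists_dist_le_of_notMem_Eh hPD hord hM hC₁ hq hC hball hC₂ hpath
  obtain ⟨D, hD, hST, hTS⟩ := exists_axisSet_close hPD hM hC₁ hq hC hball
  have hP : IsPingPongSet o h A (40 * C + 24) B (K + 2 * (3 * D + 2 * (40 * C + 24))) :=
    { C_nonneg := hC₂
      B_nonneg := hB
      K_nonneg := by positivity
      one_mem := hA1
      nprojSet_nonempty := hPD.nprojSet_image_zOrbit_nonempty o h
      pathContracting := hpath.image_smul
      dist_le_of_mem_translate := fun a ha b hb hab x hx y hy p hp q hq' => by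
        have hg : a⁻¹ * b ∉ Eh o h := fun hmem => hdistinct a ha b hb hab (by
          have := congrArg ((a • ·) '' ·) (image_smul_axisSet_of_mem_Eh hmem)
          simpa [Set.image_image, mul_smul] using this.symm)
        have htr : ∀ {z}, z ∈ (b • ·) '' zOrbit o h →
            a⁻¹ • z ∈ ((a⁻¹ * b) • ·) '' zOrbit o h := by
          rintro _ ⟨z, hz, rfl⟩
          exact ⟨z, hz, mul_smul _ _ _⟩
        have := hbdd _ hg _ (htr hx) _ (htr hy) _ (inv_smul_mem_nprojSet a hp) _
          (inv_smul_mem_nprojSet a hq')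
        rwa [dist_smul] at this
      dist_le_of_mem := fun f a ha p hp q hq' =>
        dist_le_of_diam_axisSet_le hPD hC₂ hpath hST hTS (hproj f a ha) hp hq' }
  set T := 2 * (2 * (40 * C + 24) + B + 2 * (K + 2 * (3 * D + 2 * (40 * C + 24)))) with hT
  obtain ⟨N, hN⟩ := exists_nat_gt (M * (T + C₁))
  refine ⟨N, fun n hn l l' _ _ hl hl' heq => hP.eq_of_prod_smul_eq ?_ l l' hl hl' heq⟩
  have h1 := (hq n 0).1
  have h2 : (N : ℝ) ≤ n := by exact_mod_cast hn
  have h3 : T + C₁ < 1 / M * n := by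
    rw [one_div_mul_eq_div, lt_div_iff₀ (by linarith)]
    linarith
  rw [zpow_natCast, zpow_zero, one_smul, Int.cast_zero, sub_zero, Int.cast_natCast, Nat.abs_cast,
    dist_comm] at h1
  linarith
end

section
/- Let X be a G-space with basepoint o, let Γ be a normal subgroup of G, and let h ∈ Γ be strongly contracting for the action of G on X, with axis 𝓗 and nearest-point projections π_{f𝓗}. Let D := sup_{x,y∈𝓗} inf_{m∈ℤ} d(x, h^m·y), and suppose there is C ≥ 0 such that the nearest-point projection π_𝓗 is a C-coarse map (diam π_𝓗(x) ≤ C for all x ∈ X) and is C-strongly constricting. If ḡ ∈ G satisfies d(o, ḡ·o) = inf{d(o, ḡγ·o) : γ ∈ Γ}, then for every f ∈ G, diam(π_{f𝓗}(o) ∪ π_{f𝓗}(ḡ·o)) ≤ 8C + D. -/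
open Filter Metric
open scoped ENNReal

section Defs

variable {G : Type*} {X : Type*} [Group G] [MetricSpace X] [MulAction G X]

/-- Distance between two subsets of a metric space. -/
noncomputable def setDist (S T : Set X) : ℝ := sInf (Set.image2 dist S T)

/-- A geodesic parameterized on the interval `[0, T]`. -/
def IsGeodesicOn (γ : ℝ → X) (T : ℝ) : Prop :=
  ∀ s ∈ Set.Icc (0 : ℝ) T, ∀ t ∈ Set.Icc (0 : ℝ) T, dist (γ s) (γ t) = |s - t|

/-- A `C`-coarse map from `X` to `A`: each point is assigned a nonempty subset of `A`
of diameter at most `C`. -/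
def IsCoarseMapTo (A : Set X) (C : ℝ) (π : X → Set X) : Prop :=
  ∀ x : X, (π x).Nonempty ∧ π x ⊆ A ∧ Metric.diam (π x) ≤ C

/-- `π` is `C`-strongly constricting: it coarsely agrees with the identity on `A`, and any
geodesic whose endpoints have `π`-images of diameter more than `C` passes `C`-close to the
`π`-images of both endpoints. -/
def StronglyConstrictingMap (A : Set X) (C : ℝ) (π : X → Set X) : Prop :=
  (∀ a ∈ A, Metric.diam ({a} ∪ π a) ≤ C) ∧
  ∀ (T : ℝ) (γ : ℝ → X), 0 ≤ T → IsGeodesicOn γ T →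
    C < Metric.diam (π (γ 0) ∪ π (γ T)) →
    setDist (π (γ 0)) (γ '' Set.Icc 0 T) ≤ C ∧ setDist (π (γ T)) (γ '' Set.Icc 0 T) ≤ C

end Defs

section NearestPoint

variable {X : Type*} [MetricSpace X]

theorem isBounded_nprojSet (S : Set X) (x : X) : Bornology.IsBounded (nprojSet S x) :=
  isBounded_closedBall.subset fun a ha => by
    rw [mem_closedBall, dist_comm]
    exact ha.2.le

theorem dist_le_diam_nprojSet_union {S : Set X} {x y a b : X} (ha : a ∈ nprojSet S x)
    (hb : b ∈ nprojSet S y) : dist a b ≤ diam (nprojSet S x ∪ nprojSet S y) :=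
  dist_le_diam_of_mem ((isBounded_nprojSet S x).union (isBounded_nprojSet S y))
    (Or.inl ha) (Or.inr hb)

theorem dist_le_diam_nprojSet {S : Set X} {x a b : X} (ha : a ∈ nprojSet S x)
    (hb : b ∈ nprojSet S x) : dist a b ≤ diam (nprojSet S x) :=
  dist_le_diam_of_mem (isBounded_nprojSet S x) ha hb

theorem nprojSet_image {Y : Type*} [MetricSpace Y] {φ : X → Y} (hφ : Isometry φ) (S : Set X)
    (x : X) : nprojSet (φ '' S) (φ x) = φ '' nprojSet S x := by
  ext a
  constructor
  · rintro ⟨⟨b, hb, rfl⟩, h⟩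
    exact ⟨b, ⟨hb, by rwa [hφ.dist_eq, infDist_image hφ] at h⟩, rfl⟩
  · rintro ⟨b, ⟨hb, h⟩, rfl⟩
    exact ⟨⟨b, hb, rfl⟩, by rwa [hφ.dist_eq, infDist_image hφ]⟩

theorem exists_dist_lt_of_setDist_le {S T : Set X} {C ε : ℝ} (hS : S.Nonempty)
    (hT : T.Nonempty) (h : setDist S T ≤ C) (hε : 0 < ε) :
    ∃ p ∈ S, ∃ u ∈ T, dist p u < C + ε := by
  obtain ⟨_, ⟨p, hp, u, hu, rfl⟩, hlt⟩ :=
    exists_lt_of_csInf_lt (hS.image2 hT) (show sInf (Set.image2 dist S T) < C + ε from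
      h.trans_lt (lt_add_of_pos_right C hε))
  exact ⟨p, hp, u, hu, hlt⟩

/-- Each point has a nearest point in the range of a quasi-isometric embedding of `ℤ`. -/
theorem nprojSet_range_nonempty {p : ℤ → X} {M C : ℝ} (hM : 0 < M)
    (hp : ∀ i j : ℤ, (1 / M) * |(i : ℝ) - (j : ℝ)| - C ≤ dist (p i) (p j)) (x : X) :
    (nprojSet (Set.range p) x).Nonempty := by
  have htend : Tendsto (fun i : ℤ => dist x (p i)) cofinite atTop := by
    have habs : Tendsto (fun i : ℤ => |(i : ℝ)|) cofinite atTop := by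
      exact (tendsto_norm_cocompact_atTop (E := ℝ)).comp Int.tendsto_coe_cofinite
    refine tendsto_atTop_mono (fun i => ?_)
      (tendsto_atTop_add_const_right _ (-C - dist x (p 0))
        (habs.const_mul_atTop (one_div_pos.mpr hM)))
    have h0 := hp i 0
    have h1 := dist_triangle_left (p i) (p 0) x
    simp only [Int.cast_zero, sub_zero] at h0
    linarith
  obtain ⟨i, hi⟩ := htend.exists_forall_le
  refine ⟨p i, ⟨i, rfl⟩, le_antisymm ?_ (infDist_le_dist_of_mem ⟨i, rfl⟩)⟩
  refine (le_infDist (Set.range_nonempty p)).mpr ?_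
  rintro _ ⟨j, rfl⟩
  exact hi j

end NearestPoint

section Excursion

variable {X : Type*} [MetricSpace X] {A : Set X} {C s B c : ℝ} {q : ℤ → X}

/-- A path with steps at most `s` that progresses faster than the contraction constant makes only
short excursions out of the `(s + C)`-neighborhood of a contracting set. -/
theorem excursion_length_le (hne : ∀ x, (nprojSet A x).Nonempty)
    (hA : ∀ x y : X, dist x y < infDist x A - C → diam (nprojSet A x ∪ nprojSet A y) ≤ C)
    (hstep : ∀ i, dist (q i) (q (i + 1)) ≤ s)
    (hlow : ∀ (m : ℤ) (k : ℕ), (C + 1) * k - B ≤ dist (q m) (q (m + k)))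
    (m : ℤ) (k : ℕ) (hfar : ∀ i : ℕ, i < k → s + C < infDist (q (m + i)) A) :
    (k : ℝ) ≤ B + infDist (q m) A + infDist (q (m + k)) A := by
  choose r hr using hne
  have hproj : ∀ n : ℕ, n ≤ k → dist (r (q m)) (r (q (m + n))) ≤ n * C := by
    intro n
    induction n with
    | zero => intro _; simp
    | succ n ih =>
      intro hn
      have h1 := ih (by omega)
      have h2 := hstep (m + n)
      have h3 := hfar n (by omega)
      have h4 := (dist_le_diam_nprojSet_union (hr (q (m + n))) (hr (q (m + n + 1)))).trans
        (hA (q (m + n)) (q (m + n + 1)) (by linarith))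
      have h5 := dist_triangle (r (q m)) (r (q (m + n))) (r (q (m + n + 1)))
      push_cast
      rw [← add_assoc]
      linarith
  have h1 := hproj k le_rfl
  have h2 := hlow m k
  have h3 := dist_triangle4 (q m) (r (q m)) (r (q (m + k))) (q (m + k))
  rw [dist_comm (r (q (m + k))), (hr (q m)).2, (hr (q (m + k))).2] at h3
  linarith

theorem exists_infDist_le_of_bounded (hne : ∀ x, (nprojSet A x).Nonempty)
    (hA : ∀ x y : X, dist x y < infDist x A - C → diam (nprojSet A x ∪ nprojSet A y) ≤ C)
    (hstep : ∀ i, dist (q i) (q (i + 1)) ≤ s)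
    (hlow : ∀ (m : ℤ) (k : ℕ), (C + 1) * k - B ≤ dist (q m) (q (m + k)))
    (hc : ∀ i, infDist (q i) A ≤ c) : ∃ b : ℕ, infDist (q b) A ≤ s + C := by
  by_contra! hcon
  obtain ⟨k, hk⟩ := exists_nat_gt (B + c + c)
  have h1 := excursion_length_le hne hA hstep hlow 0 k (fun i _ => by simpa using hcon i)
  have h2 := hc 0
  have h3 := hc (0 + k)
  linarith

/-- The bound on the distance does not depend on `c`. -/
theorem infDist_le_of_bounded (hs : 0 ≤ s) (hB : 0 ≤ B) (hC : 0 ≤ C)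
    (hne : ∀ x, (nprojSet A x).Nonempty)
    (hA : ∀ x y : X, dist x y < infDist x A - C → diam (nprojSet A x ∪ nprojSet A y) ≤ C)
    (hstep : ∀ i, dist (q i) (q (i + 1)) ≤ s)
    (hlow : ∀ (m : ℤ) (k : ℕ), (C + 1) * k - B ≤ dist (q m) (q (m + k)))
    (hc : ∀ i, infDist (q i) A ≤ c) :
    infDist (q 0) A ≤ s + C + (B + 3 * s + 2 * C) * s := by
  classical
  by_cases h0 : infDist (q 0) A ≤ s + C
  · exact h0.trans (le_add_of_nonneg_right (by positivity))
  have hb := exists_infDist_le_of_bounded hne hA hstep hlow hc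
  have ha : ∃ a : ℕ, infDist (q (-a)) A ≤ s + C := by
    refine exists_infDist_le_of_bounded (q := fun i => q (-i)) (s := s) (B := B) hne hA
      (fun i => ?_) (fun m k => ?_) (fun i => hc _)
    · have := hstep (-i - 1)
      rw [dist_comm]
      simpa [neg_add, sub_eq_add_neg, add_comm] using this
    · have := hlow (-(m + k)) k
      rw [dist_comm]
      simpa [neg_add] using this
  obtain ⟨b, hb1, hb2⟩ : ∃ b : ℕ, infDist (q b) A ≤ s + C ∧
      ∀ i < b, s + C < infDist (q i) A :=
    ⟨Nat.find hb, Nat.find_spec hb, fun i hi => not_le.mp (Nat.find_min hb hi)⟩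
  obtain ⟨a, ha1, ha2⟩ : ∃ a : ℕ, infDist (q (-a)) A ≤ s + C ∧
      ∀ i < a, s + C < infDist (q (-(i : ℤ))) A :=
    ⟨Nat.find ha, Nat.find_spec ha, fun i hi => not_le.mp (Nat.find_min ha hi)⟩
  obtain ⟨a, rfl⟩ : ∃ a', a = a' + 1 :=
    Nat.exists_eq_succ_of_ne_zero (by rintro rfl; exact h0 (by simpa using ha1))
  have hlen := excursion_length_le hne hA hstep hlow (-a) (a + b) (fun i hi => by
    rcases le_total a i with hai | hia
    · obtain ⟨j, rfl⟩ := Nat.exists_eq_add_of_le hai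
      simpa using hb2 j (by omega)
    · obtain ⟨j, rfl⟩ := Nat.exists_eq_add_of_le hia
      simpa using ha2 j (by omega))
  have hend : infDist (q (-a)) A ≤ s + C + s := by
    have h1 := hstep (-((a + 1 : ℕ) : ℤ))
    have h2 : -((a + 1 : ℕ) : ℤ) + 1 = -a := by push_cast; ring
    rw [h2, dist_comm] at h1
    exact infDist_le_infDist_add_dist.trans (add_le_add ha1 h1)
  have hdist : ∀ n : ℕ, dist (q 0) (q n) ≤ n * s := by
    intro n
    induction n with
    | zero => simp
    | succ n ih =>
      have h1 := hstep n
      have h2 := dist_triangle (q 0) (q n) (q (n + 1))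
      push_cast
      linarith
  have hend' : infDist (q (-a + (a + b : ℕ))) A ≤ s + C := by simpa using hb1
  have hbound : (b : ℝ) ≤ B + 3 * s + 2 * C := by
    push_cast at hlen hend'
    have : (0 : ℝ) ≤ a := a.cast_nonneg
    linarith
  calc infDist (q 0) A ≤ infDist (q b) A + dist (q 0) (q b) := infDist_le_infDist_add_dist
    _ ≤ s + C + b * s := add_le_add hb1 (hdist b)
    _ ≤ _ := by gcongr

end Excursion

section Axis

variable {G X : Type*} [Group G] [MetricSpace X] [MulAction G X] {o : X} {h : G}

/-- The axis lies in a bounded neighborhood of the `⟨h⟩`-orbit. -/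
theorem exists_infDist_zOrbit_le (hIso : IsometricAction G X) (hSC : StronglyContractingElem o h) :
    ∃ c : ℝ, ∀ x ∈ axisSet o h, infDist x (zOrbit o h) ≤ c := by
  obtain ⟨-, ⟨M, B, hM, hB, hq⟩, C, hC, hA⟩ := hSC
  have hM0 : 0 < M := by linarith
  obtain ⟨K, hK⟩ := exists_nat_ge (M * (C + 1))
  refine ⟨M * K + B + C + (B + 3 * (M * K + B) + 2 * C) * (M * K + B), ?_⟩
  rintro _ ⟨g, ⟨c, -, hg, -⟩, rfl⟩
  have hdist : ∀ i j : ℤ, dist (g • h ^ ((K : ℤ) * i) • o) (g • h ^ ((K : ℤ) * j) • o) =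
      dist (h ^ ((K : ℤ) * i) • o) (h ^ ((K : ℤ) * j) • o) := fun i j => hIso _ _ _
  have := infDist_le_of_bounded (A := zOrbit o h) (C := C) (s := M * K + B) (B := B) (c := c)
    (q := fun i : ℤ => g • h ^ ((K : ℤ) * i) • o) (by positivity) hB hC
    (nprojSet_range_nonempty hM0 fun i j => (hq i j).1) hA
    (fun i => ?_) (fun m k => ?_) (fun i => hg _ ⟨_, ⟨(K : ℤ) * i, rfl⟩, rfl⟩)
  · simpa using this
  · rw [hdist]
    refine (hq _ _).2.trans (le_of_eq ?_)
    push_cast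
    rw [show (K : ℝ) * i - K * (i + 1) = -K by ring, abs_neg, Nat.abs_cast]
  · rw [hdist]
    refine le_trans ?_ (hq _ _).1
    push_cast
    rw [show (K : ℝ) * m - K * (m + k) = -(K * k) by ring, abs_neg,
      abs_of_nonneg (by positivity)]
    have h1 : C + 1 ≤ 1 / M * K := by
      rw [one_div, ← div_eq_inv_mul, le_div_iff₀ hM0]
      linarith
    rw [← mul_assoc]
    gcongr

theorem bddBelow_range_dist_zpow_smul (x y : X) :
    BddBelow (Set.range fun m : ℤ => dist x (h ^ m • y)) :=
  ⟨0, by rintro _ ⟨m, rfl⟩; exact dist_nonneg⟩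

theorem exists_iInf_dist_zpow_smul_le (hIso : IsometricAction G X)
    (hSC : StronglyContractingElem o h) :
    ∃ c : ℝ, ∀ x ∈ axisSet o h, ∀ y ∈ axisSet o h, ⨅ m : ℤ, dist x (h ^ m • y) ≤ c := by
  obtain ⟨c, hc⟩ := exists_infDist_zOrbit_le hIso hSC
  have hnear : ∀ x ∈ axisSet o h, ∃ i : ℤ, dist x (h ^ i • o) < c + 1 := fun x hx => by
    obtain ⟨_, ⟨i, rfl⟩, hi⟩ := (infDist_lt_iff (s := zOrbit o h) ⟨_, 0, rfl⟩).mp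
      ((hc x hx).trans_lt (lt_add_one c))
    exact ⟨i, hi⟩
  refine ⟨c + 1 + (c + 1), fun x hx y hy => ?_⟩
  obtain ⟨i, hi⟩ := hnear x hx
  obtain ⟨j, hj⟩ := hnear y hy
  refine (ciInf_le (bddBelow_range_dist_zpow_smul x y) (i - j)).trans ?_
  have h1 : dist (h ^ i • o) (h ^ (i - j) • y) = dist y (h ^ j • o) := by
    rw [dist_comm, ← hIso (h ^ (i - j)) y, smul_smul, ← zpow_add, sub_add_cancel]
  have h2 := dist_triangle x (h ^ i • o) (h ^ (i - j) • y)
  linarith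

theorem iInf_dist_zpow_smul_le_iSup (hIso : IsometricAction G X)
    (hSC : StronglyContractingElem o h) {x y : X} (hx : x ∈ axisSet o h) (hy : y ∈ axisSet o h) :
    ⨅ m : ℤ, dist x (h ^ m • y) ≤
      ⨆ x : axisSet o h, ⨆ y : axisSet o h, ⨅ m : ℤ, dist (x : X) (h ^ m • (y : X)) := by
  obtain ⟨c, hc⟩ := exists_iInf_dist_zpow_smul_le hIso hSC
  have : Nonempty (axisSet o h) := ⟨⟨x, hx⟩⟩
  refine le_trans ?_ (le_ciSup (f := fun x : axisSet o h => ⨆ y : axisSet o h,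
    ⨅ m : ℤ, dist (x : X) (h ^ m • (y : X))) ⟨c, ?_⟩ ⟨x, hx⟩)
  · refine le_ciSup (f := fun y : axisSet o h => ⨅ m : ℤ, dist x (h ^ m • (y : X)))
      ⟨c, ?_⟩ ⟨y, hy⟩
    rintro _ ⟨z, rfl⟩
    exact hc x hx z z.2
  · rintro _ ⟨z, rfl⟩
    exact ciSup_le fun w => hc z z.2 w w.2

end Axis

/-- If a geodesic passes close to nearest points `p` and `q` of its endpoints `P` and `Q`, then
`p` and `q` are no further apart than the minimality of `dist P Q` allows. -/
theorem dist_nearest_le {X : Type*} [MetricSpace X] {γ : ℝ → X} {T s t δ D : ℝ} {p q : X}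
    (hγ : IsGeodesicOn γ T) (hs : s ∈ Set.Icc 0 T) (ht : t ∈ Set.Icc 0 T) (hD : 0 ≤ D)
    (hps : dist p (γ s) ≤ δ) (hqt : dist q (γ t) ≤ δ)
    (hnear : dist (γ 0) p ≤ dist (γ 0) q)
    (hmin : dist (γ 0) (γ T) ≤ dist (γ 0) p + D + dist (γ T) q) :
    dist p q ≤ 4 * δ + D := by
  have hT : 0 ≤ T := hs.1.trans hs.2
  have h0 : (0 : ℝ) ∈ Set.Icc 0 T := ⟨le_rfl, hT⟩
  have hT' : T ∈ Set.Icc 0 T := ⟨hT, le_rfl⟩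
  have e1 : dist (γ 0) (γ s) = s := by rw [hγ 0 h0 s hs, zero_sub, abs_neg, abs_of_nonneg hs.1]
  have e2 : dist (γ 0) (γ t) = t := by rw [hγ 0 h0 t ht, zero_sub, abs_neg, abs_of_nonneg ht.1]
  have e3 : dist (γ 0) (γ T) = T := by rw [hγ 0 h0 T hT', zero_sub, abs_neg, abs_of_nonneg hT]
  have e4 : dist (γ T) (γ t) = T - t := by
    rw [hγ T hT' t ht, abs_of_nonneg (sub_nonneg.mpr ht.2)]
  have h1 := dist_triangle4_right p q (γ s) (γ t)
  have h2 := dist_triangle_right (γ 0) p (γ s)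
  have h3 := dist_triangle_right (γ T) q (γ t)
  have h4 := dist_triangle (γ 0) p (γ s)
  have h5 := dist_triangle_right (γ 0) q (γ t)
  rw [hγ s hs t ht] at h1
  rcases abs_cases (s - t) with ⟨h6, -⟩ | ⟨h6, -⟩ <;> linarith

/-- **Lemma (the minimal section has bounded projections).** Let `h ∈ Γ` be strongly
contracting with axis `𝓗`, with the nearest-point projection to `𝓗` a `C`-coarse,
`C`-strongly constricting map, and let `D = sup_{x,y∈𝓗} inf_{m∈ℤ} d(x, hᵐ·y)`. If
`ḡ` realizes the minimal distance `d(o, ḡΓ·o)` in its coset, then the projection of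
`{o, ḡ·o}` to every translate `f·𝓗` has diameter at most `8C + D`. -/
theorem minimal_section_bounded_projection
    {G X : Type*} [Group G] [MetricSpace X] [MulAction G X] (o : X)
    (hProp : ProperSpace X) (hGeo : GeodesicSpace X)
    (hIso : IsometricAction G X) (hPD : ProperlyDiscontinuousAction G X)
    (Γ : Subgroup G) (hN : Γ.Normal)
    (h : G) (hhΓ : h ∈ Γ) (hSC : StronglyContractingElem o h)
    (C : ℝ) (hC : 0 ≤ C)
    (hcoarse : IsCoarseMapTo (axisSet o h) C (fun x => nprojSet (axisSet o h) x))
    (hconstrict : StronglyConstrictingMap (axisSet o h) C (fun x => nprojSet (axisSet o h) x))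
    (gbar : G) (hmin : dist o (gbar • o) = ⨅ γ : Γ, dist o ((gbar * γ) • o)) :
    ∀ f : G,
      Metric.diam (nprojSet ((f • ·) '' axisSet o h) o ∪
          nprojSet ((f • ·) '' axisSet o h) (gbar • o)) ≤
        8 * C + ⨆ x : axisSet o h, ⨆ y : axisSet o h, ⨅ m : ℤ, dist (x : X) (h ^ m • (y : X)) := by
  intro f
  set D := ⨆ x : axisSet o h, ⨆ y : axisSet o h, ⨅ m : ℤ, dist (x : X) (h ^ m • (y : X))
  have hD : 0 ≤ D :=
    Real.iSup_nonneg fun _ => Real.iSup_nonneg fun _ => Real.iInf_nonneg fun _ => dist_nonneg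
  have hisom : Isometry (f • · : X → X) := Isometry.of_dist_eq (hIso f)
  obtain ⟨P, hP⟩ : ∃ P, f • P = o := ⟨f⁻¹ • o, smul_inv_smul f o⟩
  obtain ⟨Q, hQ⟩ : ∃ Q, f • Q = gbar • o := ⟨f⁻¹ • gbar • o, smul_inv_smul f _⟩
  have hmin' : ∀ m : ℤ, dist P Q ≤ dist P (h ^ m • Q) := by
    intro m
    have hmem : gbar⁻¹ * (f * h ^ m * f⁻¹) * gbar ∈ Γ := by
      simpa using hN.conj_mem _ (hN.conj_mem _ (Γ.zpow_mem hhΓ m) f) gbar⁻¹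
    have h1 := ciInf_le (f := fun γ : Γ => dist o ((gbar * γ) • o))
      ⟨0, by rintro _ ⟨γ, rfl⟩; exact dist_nonneg⟩ ⟨_, hmem⟩
    have h2 : (gbar * (gbar⁻¹ * (f * h ^ m * f⁻¹) * gbar)) • o = f • h ^ m • Q := by
      rw [show gbar * (gbar⁻¹ * (f * h ^ m * f⁻¹) * gbar) = f * h ^ m * f⁻¹ * gbar by group,
        mul_smul, ← hQ, mul_smul, inv_smul_smul, mul_smul]
    have h3 : dist (f • P) (f • Q) ≤ dist (f • P) (f • h ^ m • Q) := by
      simpa only [← hmin, h2, hQ, hP] using h1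
    rwa [hIso, hIso] at h3
  have hprojP := nprojSet_image hisom (axisSet o h) P
  have hprojQ := nprojSet_image hisom (axisSet o h) Q
  simp only [hP, hQ] at hprojP hprojQ
  rw [hprojP, hprojQ, ← Set.image_union, hisom.diam_image]
  clear hprojP hprojQ hP hQ
  rcases le_or_gt (diam (nprojSet (axisSet o h) P ∪ nprojSet (axisSet o h) Q)) C with hle | hgt
  · linarith
  obtain ⟨T, hT, γ, rfl, rfl, hγ⟩ : ∃ T : ℝ, 0 ≤ T ∧ ∃ γ : ℝ → X, γ 0 = P ∧ γ T = Q ∧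
      IsGeodesicOn γ T := ⟨dist P Q, dist_nonneg, hGeo P Q⟩
  obtain ⟨hP, hQ'⟩ := hconstrict.2 T γ hT hγ hgt
  have him : (γ '' Set.Icc 0 T).Nonempty := ⟨_, 0, ⟨le_rfl, hT⟩, rfl⟩
  obtain ⟨hPne, hPsub, hPdiam⟩ := hcoarse (γ 0)
  obtain ⟨hQne, hQsub, hQdiam⟩ := hcoarse (γ T)
  refine le_of_forall_pos_le_add fun ε hε => ?_
  obtain ⟨p, hp, _, ⟨s, hs, rfl⟩, hps⟩ :=
    exists_dist_lt_of_setDist_le hPne him hP (show 0 < ε / 5 by positivity)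
  obtain ⟨q, hq, _, ⟨t, ht, rfl⟩, hqt⟩ :=
    exists_dist_lt_of_setDist_le hQne him hQ' (show 0 < ε / 5 by positivity)
  obtain ⟨m, hm⟩ := exists_lt_of_ciInf_lt
    ((iInf_dist_zpow_smul_le_iSup hIso hSC (hPsub hp) (hQsub hq)).trans_lt
      (lt_add_of_pos_right D (show 0 < ε / 5 by positivity)))
  have hpq : dist p q ≤ 4 * (C + ε / 5) + (D + ε / 5) := by
    refine dist_nearest_le hγ hs ht (by positivity) hps.le hqt.le
      (hp.2.le.trans (infDist_le_dist_of_mem (hQsub hq))) ?_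
    have h1 := dist_triangle4 (γ 0) p (h ^ m • q) (h ^ m • γ T)
    rw [hIso, dist_comm q] at h1
    linarith [hmin' m]
  have hcross : ∀ a ∈ nprojSet (axisSet o h) (γ 0), ∀ b ∈ nprojSet (axisSet o h) (γ T),
      dist a b ≤ 8 * C + D + ε := by
    intro a ha b hb
    have h1 := dist_triangle4 a p q b
    have h2 := (dist_le_diam_nprojSet ha hp).trans hPdiam
    have h3 := (dist_le_diam_nprojSet hq hb).trans hQdiam
    linarith
  refine diam_le_of_forall_dist_le (by positivity) ?_
  rintro a (ha | ha) b (hb | hb)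
  · linarith [(dist_le_diam_nprojSet ha hb).trans hPdiam]
  · exact hcross a ha b hb
  · rw [dist_comm]
    exact hcross b hb a ha
  · linarith [(dist_le_diam_nprojSet ha hb).trans hQdiam]
end
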